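/- Let d ≥ 1 and let Φ be a finite set of atomic τ₀-constraints over variables v₁,…,v_d. If Φ is simultaneously satisfiable in ℚ ×ₗₑₓ ℚ, then Φ has a simultaneous solution in ℚ ×ₗₑₓ ℚ with all values in D_{Φ,d} := (−C^⋆_{Φ,d}) ∪ {0} ∪ C^⋆_{Φ,d}, where C^⋆_{Φ,d} := { x + n·x·ε : x ∈ C_{Φ,d}, n ∈ ℤ, −d ≤ n ≤ d }. (This is the correctness of the sampling construction: a conjunction of atomic τ₀-constraints in at most d variables is satisfiable in ℚ ×ₗₑₓ ℚ if and only if it is satisfiable in the finite substructure with domain D_{Φ,d}.) -/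

import Mathlib

/-- An atomic `τ₀`-constraint over variables `v₁,…,v_d`: one of the forms
`c₁·v_i σ c₂·v_j`, `c·v_i σ k`, or `k σ c·v_i`, where `σ ∈ {<,=}` is encoded by
the Boolean `strict` (`true` for `<`, `false` for `=`). -/
inductive Atom (d : ℕ) : Type
  | vv (c₁ c₂ : ℚ) (i j : Fin d) (strict : Bool)
  | vk (c k : ℚ) (i : Fin d) (strict : Bool)
  | kv (k c : ℚ) (i : Fin d) (strict : Bool)
  deriving DecidableEq

/-- Well-formedness: the coefficients are nonzero and, in two-variable
constraints, not both negative. -/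
def Atom.WellFormed {d : ℕ} : Atom d → Prop
  | .vv c₁ c₂ _ _ _ => c₁ ≠ 0 ∧ c₂ ≠ 0 ∧ ¬(c₁ < 0 ∧ c₂ < 0)
  | .vk c _ _ _ => c ≠ 0
  | .kv _ c _ _ => c ≠ 0

/-- Satisfaction of an atomic constraint in `ℚ` under the assignment `x`,
where the strict symbol `<` is interpreted by the relation `lt` (take
`(· < ·)` for the constraint itself, and `(· ≤ ·)` for its closure). -/
def Atom.Holds {d : ℕ} (lt : ℚ → ℚ → Prop) (x : Fin d → ℚ) : Atom d → Prop
  | .vv c₁ c₂ i j s => if s then lt (c₁ * x i) (c₂ * x j) else c₁ * x i = c₂ * x j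
  | .vk c k i s => if s then lt (c * x i) k else c * x i = k
  | .kv k c i s => if s then lt k (c * x i) else k = c * x i

/-- `H(Φ) := {c₁/c₂ : some constraint c₁·v_i σ c₂·v_j is in Φ}`. -/
def Hset {d : ℕ} (Φ : Finset (Atom d)) : Set ℚ :=
  { h | ∃ c₁ c₂ i j s, Atom.vv c₁ c₂ i j s ∈ Φ ∧ h = c₁ / c₂ }

/-- `K(Φ) := {k/c : some constraint c·v_i σ k or k σ c·v_i is in Φ}`. -/
def Kset {d : ℕ} (Φ : Finset (Atom d)) : Set ℚ :=
  { q | ∃ c k i s, (Atom.vk c k i s ∈ Φ ∨ Atom.kv k c i s ∈ Φ) ∧ q = k / c }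

/-- `C_{Φ,d} := { |k|·∏_{r=1}^s |h_r|^{e_r} : k ∈ K(Φ) ∪ {1}, e ∈ ℤ^s,
Σ_r |e_r| < d }`, where `h₁,…,h_s` is an enumeration of `H(Φ)`. -/
def Cset {d : ℕ} (Φ : Finset (Atom d)) : Set ℚ :=
  { x | ∃ k : ℚ, (k ∈ Kset Φ ∨ k = 1) ∧
      ∃ (s : ℕ) (h : Fin s → ℚ) (e : Fin s → ℤ),
        Function.Injective h ∧ (∀ q, q ∈ Hset Φ ↔ ∃ r, h r = q) ∧
        (∑ r, (e r).natAbs) < d ∧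
        x = |k| * ∏ r, |h r| ^ (e r) }

/-- The embedding `q ↦ q + 0ε` of `ℚ` into `ℚ ×ₗₑₓ ℚ`. -/
def qlex (q : ℚ) : ℚ ×ₗ ℚ := toLex (q, 0)

/-- Componentwise scalar multiplication `c·(x,y) = (cx, cy)` on `ℚ ×ₗₑₓ ℚ`. -/
def qsmul (c : ℚ) (p : ℚ ×ₗ ℚ) : ℚ ×ₗ ℚ := toLex (c * (ofLex p).1, c * (ofLex p).2)

/-- Satisfaction of an atomic `τ₀`-constraint in `ℚ ×ₗₑₓ ℚ`, where `<` is the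
lexicographic order, rational constants `k` are read as `k + 0ε`, and `c·` is
componentwise scalar multiplication. -/
def Atom.HoldsLex {d : ℕ} (x : Fin d → ℚ ×ₗ ℚ) : Atom d → Prop
  | .vv c₁ c₂ i j s =>
      if s then qsmul c₁ (x i) < qsmul c₂ (x j) else qsmul c₁ (x i) = qsmul c₂ (x j)
  | .vk c k i s => if s then qsmul c (x i) < qlex k else qsmul c (x i) = qlex k
  | .kv k c i s => if s then qlex k < qsmul c (x i) else qlex k = qsmul c (x i)

/-- `C^⋆_{Φ,d} := { x + n·x·ε : x ∈ C_{Φ,d}, n ∈ ℤ, −d ≤ n ≤ d } ⊆ ℚ ×ₗₑₓ ℚ`,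
where `x + n·x·ε` is the pair `(x, n·x)`. -/
def CstarSet {d : ℕ} (Φ : Finset (Atom d)) : Set (ℚ ×ₗ ℚ) :=
  { p | ∃ x ∈ Cset Φ, ∃ n : ℤ, -(d : ℤ) ≤ n ∧ n ≤ d ∧ p = toLex (x, (n : ℚ) * x) }

/-- `D_{Φ,d} := (−C^⋆_{Φ,d}) ∪ {0} ∪ C^⋆_{Φ,d}`. -/
def Dset {d : ℕ} (Φ : Finset (Atom d)) : Set (ℚ ×ₗ ℚ) :=
  { p | (∃ q ∈ CstarSet Φ, p = toLex (-(ofLex q).1, -(ofLex q).2)) ∨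
        p = toLex ((0 : ℚ), (0 : ℚ)) ∨ p ∈ CstarSet Φ }


abbrev GG := ℝ ×ₗ ℚ

theorem core_step {G W : Type*} [AddCommGroup G] [LinearOrder G] [IsOrderedAddMonoid G]
    [Fintype W] (o : W) (E : Finset (W × W × G)) (P : ℕ → G → Prop)
    (v0 : W → G) (hv0 : v0 o = 0) (hsat : ∀ e ∈ E, v0 e.1 ≤ v0 e.2.1 + e.2.2)
    (hmono : ∀ m g, P m g → P (m+1) g)
    (hr1 : ∀ e ∈ E, e.2.1 = o → e.1 ≠ o → P 1 e.2.2)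
    (hr2 : ∀ e ∈ E, e.1 = o → e.2.1 ≠ o → P 1 (-e.2.2))
    (hs : ∀ e ∈ E, e.1 ≠ o → e.2.1 ≠ o → ∀ m g, P m g →
      P (m+1) (g + e.2.2) ∧ P (m+1) (g - e.2.2))
    (h1 : P 1 0) (m : ℕ) (hm : m + 1 ≤ Fintype.card W) :
    ∃ (v : W → G) (B : Finset W), v o = 0 ∧ (∀ e ∈ E, v e.1 ≤ v e.2.1 + e.2.2) ∧
      o ∈ B ∧ B.card = m + 1 ∧ ∀ b ∈ B, b ≠ o → P m (v b) := by
  classical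
  have h1' : ∀ m g, P 1 g → P (m+1) g := by
    intro m g hg
    induction m with
    | zero => exact hg
    | succ n ih => exact hmono _ _ ih
  induction m with
  | zero =>
    refine ⟨v0, {o}, hv0, hsat, by simp, by simp, ?_⟩
    intro b hb hbo
    simp at hb; exact absurd hb hbo
  | succ m ih =>
    obtain ⟨v, B, hvo, hv, hoB, hcard, hP⟩ := ih (by omega)
    have key : ∃ (δ : G) (r : W), r ∉ B ∧ P (m+1) (v r + δ) ∧
        ∀ e ∈ E, (e.1 ∉ B → e.2.1 ∈ B → v e.1 + δ ≤ v e.2.1 + e.2.2) ∧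
          (e.1 ∈ B → e.2.1 ∉ B → v e.1 ≤ v e.2.1 + δ + e.2.2) := by
      by_cases hE1 : (E.filter (fun e => e.1 ∉ B ∧ e.2.1 ∈ B)).Nonempty
      · obtain ⟨e, he, hmin⟩ := Finset.exists_min_image _
          (fun e : W × W × G => v e.2.1 + e.2.2 - v e.1) hE1
        simp only [Finset.mem_filter] at he hmin
        obtain ⟨heE, he1, he2⟩ := he
        have heo : e.1 ≠ o := fun h => he1 (h ▸ hoB)
        refine ⟨v e.2.1 + e.2.2 - v e.1, e.1, he1, ?_, ?_⟩
        · have : v e.1 + (v e.2.1 + e.2.2 - v e.1) = v e.2.1 + e.2.2 := by abel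
          rw [this]
          by_cases h : e.2.1 = o
          · rw [h, hvo, zero_add]; exact h1' _ _ (hr1 e heE h heo)
          · exact (hs e heE heo h m _ (hP _ he2 h)).1
        · intro e' he'
          refine ⟨fun ha hb => ?_, fun ha hb => ?_⟩
          · have := hmin e' ⟨he', ha, hb⟩
            have := add_le_add_right this (v e'.1)
            simpa using this
          · have h0 : 0 ≤ v e.2.1 + e.2.2 - v e.1 := sub_nonneg.2 (hv e heE)
            calc v e'.1 ≤ v e'.2.1 + e'.2.2 := hv e' he'
              _ ≤ _ := by
                have := add_le_add_right h0 (v e'.2.1 + e'.2.2)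
                rw [add_zero] at this
                convert this using 1
                abel
      · by_cases hE2 : (E.filter (fun e => e.1 ∈ B ∧ e.2.1 ∉ B)).Nonempty
        · obtain ⟨e, he, hmin⟩ := Finset.exists_min_image _
            (fun e : W × W × G => v e.2.1 + e.2.2 - v e.1) hE2
          simp only [Finset.mem_filter] at he hmin
          obtain ⟨heE, he1, he2⟩ := he
          have heo : e.2.1 ≠ o := fun h => he2 (h ▸ hoB)
          refine ⟨-(v e.2.1 + e.2.2 - v e.1), e.2.1, he2, ?_, ?_⟩
          · have : v e.2.1 + -(v e.2.1 + e.2.2 - v e.1) = v e.1 - e.2.2 := by abel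
            rw [this]
            by_cases h : e.1 = o
            · rw [h, hvo, zero_sub]; exact h1' _ _ (hr2 e heE h heo)
            · exact (hs e heE h heo m _ (hP _ he1 h)).2
          · intro e' he'
            refine ⟨fun ha hb => ?_, fun ha hb => ?_⟩
            · exact absurd ⟨e', Finset.mem_filter.2 ⟨he', ha, hb⟩⟩ hE1
            · have := hmin e' ⟨he', ha, hb⟩
              rw [← sub_nonneg] at this ⊢
              convert this using 1
              abel
        · have : ∃ r, r ∉ B := by
            by_contra! hcon
            have : B = Finset.univ := by ext; simp [hcon]
            rw [this, Finset.card_univ] at hcard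
            omega
          obtain ⟨r, hr⟩ := this
          refine ⟨-v r, r, hr, by simpa using h1' _ _ h1, ?_⟩
          intro e' he'
          refine ⟨fun ha hb => ?_, fun ha hb => ?_⟩
          · exact absurd ⟨e', Finset.mem_filter.2 ⟨he', ha, hb⟩⟩ hE1
          · exact absurd ⟨e', Finset.mem_filter.2 ⟨he', ha, hb⟩⟩ hE2
    obtain ⟨δ, r, hr, hPr, hδ⟩ := key
    refine ⟨fun i => if i ∈ B then v i else v i + δ, insert r B, by simp [hoB, hvo], ?_,
      by simp [hoB], by rw [Finset.card_insert_of_notMem hr, hcard], ?_⟩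
    · intro e he
      have h := hδ e he
      have h' := hv e he
      by_cases ha : e.1 ∈ B <;> by_cases hb : e.2.1 ∈ B <;> simp only [ha, hb, if_true, if_false]
      · exact h'
      · exact h.2 ha hb
      · exact h.1 ha hb
      · rw [add_right_comm]; exact add_le_add_left h' δ
    · intro b hb hbo
      rcases Finset.mem_insert.1 hb with rfl | hb
      · simpa [hr] using hPr
      · simpa [hb] using hmono _ _ (hP b hb hbo)

/-- rational values and their logarithmic encoding -/
def Dec (u : ℚ ×ₗ ℚ) (v : GG) : Prop :=
  ∃ x n : ℚ, 0 < x ∧ u = toLex (x, n * x) ∧ v = toLex (Real.log x, n)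

def RelB (s : Bool) (p q : ℚ ×ₗ ℚ) : Prop := if s then p < q else p = q

noncomputable def VV (t : ℚ) (p : ℚ ×ₗ ℚ) : GG :=
  if 0 < (ofLex p).1 then toLex (Real.log ((ofLex p).1 : ℚ), t⁻¹ * ((ofLex p).2 / (ofLex p).1))
  else toLex (Real.log ((t * (ofLex p).2 : ℚ)), 0)

theorem gg_le (a b c : ℝ) (x y z : ℚ) :
    (toLex (a, x) : GG) ≤ toLex (b, y) + toLex (c, z) ↔ a < b + c ∨ a = b + c ∧ x ≤ y + z := by
  rw [← toLex_add, Prod.mk_add_mk, Prod.Lex.toLex_le_toLex]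

theorem lq_lt (a b x y : ℚ) :
    (toLex (a, x) : ℚ ×ₗ ℚ) < toLex (b, y) ↔ a < b ∨ a = b ∧ x < y := by
  rw [Prod.Lex.toLex_lt_toLex]

theorem log_lt_iff {x y α β : ℚ} (hx : 0 < x) (hy : 0 < y) (hα : 0 < α) (hβ : 0 < β) :
    Real.log x < Real.log y + Real.log ((β / α : ℚ)) ↔ α * x < β * y := by
  have h1 : (0:ℚ) < β / α := by positivity
  rw [← Real.log_mul (by exact_mod_cast hy.ne') (by exact_mod_cast h1.ne'),
    Real.log_lt_log_iff (by exact_mod_cast hx) (by exact_mod_cast mul_pos hy h1)]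
  norm_cast
  rw [← mul_div_assoc, lt_div_iff₀ hα, mul_comm x, mul_comm y]

theorem log_eq_iff {x y α β : ℚ} (hx : 0 < x) (hy : 0 < y) (hα : 0 < α) (hβ : 0 < β) :
    Real.log x = Real.log y + Real.log ((β / α : ℚ)) ↔ α * x = β * y := by
  have h1 : (0:ℚ) < β / α := by positivity
  rw [← Real.log_mul (by exact_mod_cast hy.ne') (by exact_mod_cast h1.ne')]
  constructor
  · intro h
    have := Real.log_injOn_pos (Set.mem_Ioi.2 (by exact_mod_cast hx))
      (Set.mem_Ioi.2 (by exact_mod_cast mul_pos hy h1)) h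
    have h2 : x = y * (β / α) := by exact_mod_cast this
    rw [h2]; field_simp
  · intro h
    congr 1
    have : x = y * (β / α) := by field_simp; linarith
    exact_mod_cast this

theorem dec_lt {p q : ℚ ×ₗ ℚ} {v w : GG} (hp : Dec p v) (hq : Dec q w) {α β : ℚ}
    (hα : 0 < α) (hβ : 0 < β) (h : v ≤ w + toLex (Real.log ((β / α : ℚ)), (-1 : ℚ))) :
    qsmul α p < qsmul β q := by
  obtain ⟨x, n, hx, rfl, rfl⟩ := hp
  obtain ⟨y, m, hy, rfl, rfl⟩ := hq
  rw [gg_le, log_lt_iff hx hy hα hβ, log_eq_iff hx hy hα hβ] at h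
  simp only [qsmul, ofLex_toLex]
  rw [lq_lt]
  refine h.imp_right fun ⟨h1, h2⟩ => ⟨h1, ?_⟩
  have : α * (n * x) = n * (β * y) := by rw [← h1]; ring
  rw [this]
  nlinarith [mul_pos hβ hy]

theorem dec_le {p q : ℚ ×ₗ ℚ} {v w : GG} (hp : Dec p v) (hq : Dec q w) {α β : ℚ}
    (hα : 0 < α) (hβ : 0 < β) (h : v ≤ w + toLex (Real.log ((β / α : ℚ)), (0 : ℚ))) :
    qsmul α p ≤ qsmul β q := by
  obtain ⟨x, n, hx, rfl, rfl⟩ := hp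
  obtain ⟨y, m, hy, rfl, rfl⟩ := hq
  rw [gg_le, log_lt_iff hx hy hα hβ, log_eq_iff hx hy hα hβ] at h
  simp only [qsmul, ofLex_toLex]
  rw [Prod.Lex.toLex_le_toLex]
  refine h.imp_right fun ⟨h1, h2⟩ => ⟨h1, ?_⟩
  have : α * (n * x) = n * (β * y) := by rw [← h1]; ring
  show α * (n * x) ≤ β * (m * y)
  rw [this]
  nlinarith [mul_pos hβ hy]

theorem pos_iff (p : ℚ ×ₗ ℚ) : 0 < p ↔ 0 < (ofLex p).1 ∨ (ofLex p).1 = 0 ∧ 0 < (ofLex p).2 := by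
  have : (0 : ℚ ×ₗ ℚ) = toLex (0, 0) := rfl
  obtain ⟨a, b⟩ := p
  rw [this, show (a, b) = (toLex (a, b) : ℚ ×ₗ ℚ) from rfl, lq_lt]
  simp only [ofLex_toLex, eq_comm]

open Filter Topology in
theorem init_lt {p q : ℚ ×ₗ ℚ} (hp : 0 < p) (hq : 0 < q) {α β : ℚ}
    (hα : 0 < α) (hβ : 0 < β) (h : qsmul α p < qsmul β q) :
    ∀ᶠ t in 𝓝[>] (0 : ℚ), VV t p ≤ VV t q + toLex (Real.log ((β / α : ℚ)), (-1 : ℚ)) := by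
  rw [pos_iff] at hp hq
  rw [qsmul, qsmul, lq_lt] at h
  have hev : ∀ c : ℚ, 0 < c → ∀ᶠ t in 𝓝[>] (0 : ℚ), 0 < t ∧ t < c := fun c hc =>
    Ioo_mem_nhdsGT hc
  unfold VV
  generalize (ofLex p).1 = x, (ofLex p).2 = b, (ofLex q).1 = y, (ofLex q).2 = c at *
  rcases hp with hx | ⟨rfl, hb⟩ <;> rcases hq with hy | ⟨rfl, hc⟩
  · simp only [hx, hy, if_true, gg_le, log_lt_iff hx hy hα hβ, log_eq_iff hx hy hα hβ]
    rcases h with h | ⟨h, h'⟩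
    · exact Eventually.of_forall fun _ => Or.inl h
    · have hlt : b / x < c / y := by
        rw [div_lt_div_iff₀ hx hy]
        have h1 : α * b * (β * y) < β * c * (α * x) := by
          rw [h]; exact mul_lt_mul_of_pos_right h' (by positivity)
        have h2 : 0 < α * β := by positivity
        nlinarith
      filter_upwards [hev _ (sub_pos.2 hlt)] with t ⟨ht, ht'⟩
      refine Or.inr ⟨h, ?_⟩
      have : 1 ≤ t⁻¹ * (c / y - b / x) := by
        rw [inv_mul_eq_div, le_div_iff₀ ht]; linarith
      linarith
  · exfalso
    have := mul_pos hα hx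
    rcases h with h | ⟨h, h'⟩ <;> rw [mul_zero] at h <;> linarith
  · filter_upwards [hev (β * y / (α * b)) (by positivity)] with t ⟨ht, ht'⟩
    have h1 : 0 < t * b := by positivity
    simp only [lt_irrefl, hy, if_true, if_false, gg_le, log_lt_iff h1 hy hα hβ]
    left
    rw [lt_div_iff₀ (by positivity)] at ht'
    linarith
  · filter_upwards [hev 1 one_pos] with t ⟨ht, ht'⟩
    have h1 : 0 < t * b := by positivity
    have h2 : 0 < t * c := by positivity
    simp only [lt_irrefl, if_false, gg_le, log_lt_iff h1 h2 hα hβ]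
    left
    simp at h
    nlinarith

theorem init_le {p q : ℚ ×ₗ ℚ} (hp : 0 < p) (hq : 0 < q) {α β : ℚ}
    (hα : 0 < α) (hβ : 0 < β) (h : qsmul α p = qsmul β q) {t : ℚ} (ht : 0 < t) :
    VV t p ≤ VV t q + toLex (Real.log ((β / α : ℚ)), (0 : ℚ)) := by
  rw [pos_iff] at hp hq
  rw [qsmul, qsmul, toLex_inj, Prod.mk.injEq] at h
  unfold VV
  generalize (ofLex p).1 = x, (ofLex p).2 = b, (ofLex q).1 = y, (ofLex q).2 = c at *
  obtain ⟨h, h'⟩ := h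
  rcases hp with hx | ⟨rfl, hb⟩ <;> rcases hq with hy | ⟨rfl, hc⟩
  · simp only [hx, hy, if_true, gg_le, log_lt_iff hx hy hα hβ, log_eq_iff hx hy hα hβ]
    right
    refine ⟨h, ?_⟩
    have : b / x = c / y := by
      have e1 : b / x = (α * b) / (α * x) := by field_simp
      have e2 : c / y = (β * c) / (β * y) := by field_simp
      rw [e1, e2, h, h']
    rw [this]; simp
  · exfalso
    have := mul_pos hα hx
    linarith
  · exfalso
    have := mul_pos hβ hy
    linarith
  · have h1 : 0 < t * b := by positivity
    have h2 : 0 < t * c := by positivity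
    simp only [lt_irrefl, if_false, gg_le, log_lt_iff h1 h2 hα hβ, log_eq_iff h1 h2 hα hβ]
    right
    refine ⟨?_, by simp⟩
    linear_combination t * h'

def GoodE {W : Type*} (a b : W) (α β : ℚ) (e : W × W × GG) : Prop :=
  α ≠ 0 ∧ β ≠ 0 ∧ ∃ n : ℤ, n.natAbs ≤ 1 ∧
    ((e.1 = a ∧ e.2.1 = b ∧ e.2.2 = toLex (Real.log ((|β / α| : ℚ)), (n : ℚ))) ∨
     (e.1 = b ∧ e.2.1 = a ∧ e.2.2 = toLex (Real.log ((|α / β| : ℚ)), (n : ℚ))))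

theorem qs_pos {α : ℚ} {p : ℚ ×ₗ ℚ} (hα : 0 < α) (hp : 0 < p) : 0 < qsmul α p := by
  rw [pos_iff] at *
  simp only [qsmul, ofLex_toLex]
  rcases hp with h | ⟨h, h'⟩
  · left; positivity
  · right; exact ⟨by simp [h], by positivity⟩

theorem qs_neg (α : ℚ) (p : ℚ ×ₗ ℚ) : qsmul (-α) p = - qsmul α p := by
  simp only [qsmul]
  rw [← toLex_neg]; simp

theorem qs_zero (p : ℚ ×ₗ ℚ) : qsmul 0 p = 0 := by
  simp only [qsmul, zero_mul]; rfl

theorem dec_pos {p : ℚ ×ₗ ℚ} {v : GG} (h : Dec p v) : 0 < p := by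
  obtain ⟨x, n, hx, rfl, -⟩ := h
  rw [pos_iff]; left; simpa using hx

open Filter Topology in
theorem edges_pos {W : Type*} (u0 : W → ℚ ×ₗ ℚ) (pos : ∀ a, 0 < u0 a) (α β : ℚ)
    (hα : 0 < α) (hβ : 0 < β) (a b : W)
    (s : Bool) (h : RelB s (qsmul α (u0 a)) (qsmul β (u0 b))) :
    ∀ᶠ t in 𝓝[>] (0 : ℚ), ∃ F : Finset (W × W × GG),
      (∀ e ∈ F, VV t (u0 e.1) ≤ VV t (u0 e.2.1) + e.2.2) ∧ (∀ e ∈ F, GoodE a b α β e) ∧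
      ∀ (u : W → ℚ ×ₗ ℚ) (v : W → GG), (∀ a, Dec (u a) (v a)) →
        (∀ e ∈ F, v e.1 ≤ v e.2.1 + e.2.2) → RelB s (qsmul α (u a)) (qsmul β (u b)) := by
  classical
  cases s
  · simp only [RelB] at *
    filter_upwards [self_mem_nhdsWithin] with t ht
    refine ⟨{(a, b, toLex (Real.log ((β / α : ℚ)), (0 : ℚ))),
      (b, a, toLex (Real.log ((α / β : ℚ)), (0 : ℚ)))}, ?_, ?_, ?_⟩
    · simp only [Finset.mem_insert, Finset.mem_singleton]
      rintro e (rfl | rfl)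
      · exact init_le (pos _) (pos _) hα hβ h ht
      · exact init_le (pos _) (pos _) hβ hα h.symm ht
    · simp only [Finset.mem_insert, Finset.mem_singleton]
      rintro e (rfl | rfl)
      · exact ⟨hα.ne', hβ.ne', 0, by simp, Or.inl ⟨rfl, rfl, by rw [abs_of_pos (by positivity)]; simp⟩⟩
      · exact ⟨hα.ne', hβ.ne', 0, by simp, Or.inr ⟨rfl, rfl, by rw [abs_of_pos (by positivity)]; simp⟩⟩
    · intro u v huv hF
      have h1 := hF (a, b, toLex (Real.log ((β / α : ℚ)), (0 : ℚ))) (by simp)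
      have h2 := hF (b, a, toLex (Real.log ((α / β : ℚ)), (0 : ℚ))) (by simp)
      exact le_antisymm (dec_le (huv _) (huv _) hα hβ h1) (dec_le (huv _) (huv _) hβ hα h2)
  · simp only [RelB, if_true] at *
    filter_upwards [init_lt (pos _) (pos _) hα hβ h] with t ht
    refine ⟨{(a, b, toLex (Real.log ((β / α : ℚ)), (-1 : ℚ)))}, ?_, ?_, ?_⟩
    · simp only [Finset.mem_singleton]
      rintro e rfl
      exact ht
    · simp only [Finset.mem_singleton]
      rintro e rfl
      exact ⟨hα.ne', hβ.ne', -1, by simp, Or.inl ⟨rfl, rfl, by rw [abs_of_pos (by positivity)]; simp⟩⟩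
    · intro u v huv hF
      exact dec_lt (huv _) (huv _) hα hβ (hF _ (Finset.mem_singleton_self _))

theorem relB_neg {s : Bool} {p q : ℚ ×ₗ ℚ} : RelB s (-p) (-q) ↔ RelB s q p := by
  cases s
  · simp [RelB, eq_comm]
  · simp [RelB]

open Filter Topology in
theorem edges_all {W : Type*} (u0 : W → ℚ ×ₗ ℚ) (pos : ∀ a, 0 < u0 a) (α β : ℚ) (a b : W)
    (s : Bool) (h : RelB s (qsmul α (u0 a)) (qsmul β (u0 b))) :
    ∀ᶠ t in 𝓝[>] (0 : ℚ), ∃ F : Finset (W × W × GG),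
      (∀ e ∈ F, VV t (u0 e.1) ≤ VV t (u0 e.2.1) + e.2.2) ∧ (∀ e ∈ F, GoodE a b α β e) ∧
      ∀ (u : W → ℚ ×ₗ ℚ) (v : W → GG), (∀ a, Dec (u a) (v a)) →
        (∀ e ∈ F, v e.1 ≤ v e.2.1 + e.2.2) → RelB s (qsmul α (u a)) (qsmul β (u b)) := by
  have triv : (∀ u : W → ℚ ×ₗ ℚ, (∀ a, 0 < u a) → RelB s (qsmul α (u a)) (qsmul β (u b))) →
      ∀ᶠ t in 𝓝[>] (0 : ℚ), ∃ F : Finset (W × W × GG),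
      (∀ e ∈ F, VV t (u0 e.1) ≤ VV t (u0 e.2.1) + e.2.2) ∧ (∀ e ∈ F, GoodE a b α β e) ∧
      ∀ (u : W → ℚ ×ₗ ℚ) (v : W → GG), (∀ a, Dec (u a) (v a)) →
        (∀ e ∈ F, v e.1 ≤ v e.2.1 + e.2.2) → RelB s (qsmul α (u a)) (qsmul β (u b)) := by
    intro H
    refine Eventually.of_forall fun t => ⟨∅, by simp, by simp, ?_⟩
    intro u v huv _
    exact H u fun a => dec_pos (huv a)
  have qn : ∀ {α : ℚ} {p : ℚ ×ₗ ℚ}, α < 0 → 0 < p → qsmul α p < 0 := by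
    intro α p hα hp
    have := qs_pos (neg_pos.2 hα) hp
    rw [qs_neg] at this
    exact neg_pos.1 this
  have irr : ∀ {p q : ℚ ×ₗ ℚ}, RelB s p q → ¬ q < p := by
    intro p q h
    cases s
    · simp only [RelB] at h; simp at h; simp [h]
    · simp only [RelB, if_true] at h; exact h.not_gt
  have triv2 : (∀ u : W → ℚ ×ₗ ℚ, (∀ a, 0 < u a) → qsmul α (u a) < qsmul β (u b)) →
      ∀ u : W → ℚ ×ₗ ℚ, (∀ a, 0 < u a) → RelB s (qsmul α (u a)) (qsmul β (u b)) := by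
    intro H u hu
    cases s
    · simp only [RelB] at h
      have := H u0 pos
      simp at h
      exact absurd h this.ne
    · simpa [RelB] using H u hu
  rcases lt_trichotomy α 0 with hα | hα | hα <;> rcases lt_trichotomy β 0 with hβ | hβ | hβ
  · have hα' := neg_pos.2 hα
    have hβ' := neg_pos.2 hβ
    have h' : RelB s (qsmul (-β) (u0 b)) (qsmul (-α) (u0 a)) := by
      rw [qs_neg, qs_neg, relB_neg]; exact h
    filter_upwards [edges_pos u0 pos (-β) (-α) hβ' hα' b a s h'] with t ⟨F, h1, h2, h3⟩
    refine ⟨F, h1, ?_, ?_⟩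
    · intro e he
      obtain ⟨-, -, n, hn, hh⟩ := h2 e he
      refine ⟨hα.ne, hβ.ne, n, hn, ?_⟩
      rw [neg_div_neg_eq, neg_div_neg_eq] at hh
      exact hh.symm
    · intro u v huv hF
      have := h3 u v huv hF
      rwa [qs_neg, qs_neg, relB_neg] at this
  · subst hβ
    exact triv (triv2 fun u hu => by rw [qs_zero]; exact qn hα (hu _))
  · exact triv (triv2 fun u hu => (qn hα (hu _)).trans (qs_pos hβ (hu _)))
  · subst hα
    exact absurd (by rw [qs_zero]; exact qn hβ (pos _)) (irr h)
  · subst hα hβ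
    apply triv
    intro u hu
    rw [qs_zero, qs_zero] at *; exact h
  · subst hα
    exact triv (triv2 fun u hu => by rw [qs_zero]; exact qs_pos hβ (hu _))
  · exact absurd ((qn hβ (pos _)).trans (qs_pos hα (pos _))) (irr h)
  · subst hβ
    exact absurd (by rw [qs_zero]; exact qs_pos hα (pos _)) (irr h)
  · exact edges_pos u0 pos α β hα hβ a b s h

def PP {d : ℕ} (Φ : Finset (Atom d)) {s : ℕ} (h : Fin s → ℚ) (m : ℕ) (g : GG) : Prop :=
  ∃ k : ℚ, (k ∈ Kset Φ ∨ k = 1) ∧ k ≠ 0 ∧ ∃ e : Fin s → ℤ, (∑ r, (e r).natAbs) < m ∧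
    ∃ n : ℤ, n.natAbs ≤ m ∧ g = toLex (Real.log ((|k| * ∏ r, |h r| ^ (e r) : ℚ)), (n : ℚ))

theorem PP_mono {d : ℕ} (Φ : Finset (Atom d)) {s : ℕ} (h : Fin s → ℚ) (m : ℕ) (g : GG)
    (H : PP Φ h m g) : PP Φ h (m + 1) g := by
  obtain ⟨k, hk, hk0, e, he, n, hn, hg⟩ := H
  exact ⟨k, hk, hk0, e, by omega, n, by omega, hg⟩

theorem PP_base {d : ℕ} (Φ : Finset (Atom d)) {s : ℕ} (h : Fin s → ℚ) (k : ℚ)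
    (hk : k ∈ Kset Φ ∨ k = 1) (hk0 : k ≠ 0) (n : ℤ) (hn : n.natAbs ≤ 1) :
    PP Φ h 1 (toLex (Real.log ((|k| : ℚ)), (n : ℚ))) :=
  ⟨k, hk, hk0, 0, by simp, n, hn, by simp⟩

theorem PP_step {d : ℕ} (Φ : Finset (Atom d)) {s : ℕ} (h : Fin s → ℚ) (hne : ∀ r, h r ≠ 0)
    (m : ℕ) (g : GG) (H : PP Φ h m g) (r : Fin s) (z : ℤ) (hz : z.natAbs ≤ 1)
    (n' : ℤ) (hn' : n'.natAbs ≤ 1) :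
    PP Φ h (m + 1) (g + toLex (Real.log ((|h r| ^ z : ℚ)), (n' : ℚ))) := by
  obtain ⟨k, hk, hk0, e, he, n, hn, rfl⟩ := H
  have hpos : ∀ r, 0 < |h r| := fun r => abs_pos.2 (hne r)
  refine ⟨k, hk, hk0, fun q => e q + (if q = r then z else 0), ?_, n + n', by omega, ?_⟩
  · calc ∑ q, (e q + (if q = r then z else 0)).natAbs
        ≤ ∑ q, ((e q).natAbs + (if q = r then z.natAbs else 0)) := by
          apply Finset.sum_le_sum
          intro q _
          split_ifs <;> omega
      _ = (∑ q, (e q).natAbs) + z.natAbs := by rw [Finset.sum_add_distrib]; simp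
      _ < m + 1 := by omega
  · have hprod : ∏ q, |h q| ^ (e q + (if q = r then z else 0)) =
        (∏ q, |h q| ^ (e q)) * |h r| ^ z := by
      simp_rw [fun q => zpow_add₀ (hpos q).ne']
      rw [Finset.prod_mul_distrib]
      congr 1
      rw [Finset.prod_eq_single r]
      · simp
      · intro b _ hb; simp [hb]
      · simp
    have p1 : (0:ℚ) < |k| * ∏ q, |h q| ^ (e q) :=
      mul_pos (abs_pos.2 hk0) (Finset.prod_pos fun q _ => zpow_pos (hpos q) _)
    have p2 : (0:ℚ) < |h r| ^ z := zpow_pos (hpos r) _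
    rw [hprod, ← mul_assoc, Rat.cast_mul _ (|h r| ^ z),
      Real.log_mul (by exact_mod_cast p1.ne') (by exact_mod_cast p2.ne'), ← toLex_add,
      Prod.mk_add_mk, Int.cast_add]

def Atom.tr {d : ℕ} (σ : Fin d → ℚ) : Atom d → ℚ × Option (Fin d) × ℚ × Option (Fin d) × Bool
  | .vv c₁ c₂ i j s => (c₁ * σ i, some i, c₂ * σ j, some j, s)
  | .vk c k i s => (c * σ i, some i, k, none, s)
  | .kv k c i s => (k, none, c * σ i, some i, s)

theorem qs_qs (c s : ℚ) (p : ℚ ×ₗ ℚ) : qsmul c (qsmul s p) = qsmul (c * s) p := by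
  simp [qsmul, mul_assoc]

theorem qlex_eq (k : ℚ) : qlex k = qsmul k (qlex 1) := by
  simp [qsmul, qlex]

theorem tr_iff {d : ℕ} (σ : Fin d → ℚ) (u : Option (Fin d) → ℚ ×ₗ ℚ) (hu : u none = qlex 1)
    (a : Atom d) : a.HoldsLex (fun i => qsmul (σ i) (u (some i))) ↔
      RelB (a.tr σ).2.2.2.2 (qsmul (a.tr σ).1 (u (a.tr σ).2.1))
        (qsmul (a.tr σ).2.2.1 (u (a.tr σ).2.2.2.1)) := by
  cases a with
  | vv c₁ c₂ i j s => cases s <;> simp [Atom.HoldsLex, Atom.tr, RelB, qs_qs]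
  | vk c k i s => simp [Atom.HoldsLex, Atom.tr, RelB, qs_qs, hu, qlex_eq k]
  | kv k c i s => simp [Atom.HoldsLex, Atom.tr, RelB, qs_qs, hu, qlex_eq k]

theorem Hset_finite {d : ℕ} (Φ : Finset (Atom d)) : (Hset Φ).Finite := by
  refine (Φ.finite_toSet.image (fun a => match a with
    | .vv c₁ c₂ _ _ _ => c₁ / c₂
    | _ => (0:ℚ))).subset ?_
  rintro q ⟨c₁, c₂, i, j, s, hm, rfl⟩
  exact ⟨_, hm, rfl⟩

/-- Correctness of the sampling construction: if a finite set `Φ` of atomic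
`τ₀`-constraints over `v₁,…,v_d` is simultaneously satisfiable in `ℚ ×ₗₑₓ ℚ`,
then it has a simultaneous solution in `ℚ ×ₗₑₓ ℚ` with all values in
`D_{Φ,d}`. -/
theorem satisfiable_lex_in_Dset {d : ℕ} (hd : 1 ≤ d) (Φ : Finset (Atom d))
    (hwf : ∀ a ∈ Φ, a.WellFormed)
    (hsat : ∃ y : Fin d → ℚ ×ₗ ℚ, ∀ a ∈ Φ, a.HoldsLex y) :
    ∃ y : Fin d → ℚ ×ₗ ℚ, (∀ i, y i ∈ Dset Φ) ∧ ∀ a ∈ Φ, a.HoldsLex y := by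
  classical
  obtain ⟨y, hy⟩ := hsat
  -- enumeration of H
  obtain ⟨s, h, hinj, hrange⟩ : ∃ (s : ℕ) (h : Fin s → ℚ), Function.Injective h ∧
      ∀ q, q ∈ Hset Φ ↔ ∃ r, h r = q := by
    let S := (Hset_finite Φ).toFinset
    refine ⟨S.card, fun r => (S.equivFin.symm r : ℚ), ?_, ?_⟩
    · exact Subtype.val_injective.comp S.equivFin.symm.injective
    · intro q
      constructor
      · intro hq
        exact ⟨S.equivFin ⟨q, by simpa [S] using hq⟩, by simp⟩
      · rintro ⟨r, rfl⟩
        have := (S.equivFin.symm r).2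
        exact (Hset_finite Φ).mem_toFinset.1 this
  have hne : ∀ r, h r ≠ 0 := by
    intro r
    obtain ⟨c₁, c₂, i, j, s, hm, hr⟩ := (hrange (h r)).2 ⟨r, rfl⟩
    obtain ⟨h1, h2, -⟩ := hwf _ hm
    rw [hr]; exact div_ne_zero h1 h2
  -- signs and absolute values
  have one_pos' : (0 : ℚ ×ₗ ℚ) < qlex 1 := by rw [pos_iff]; simp [qlex]
  have habs : ∀ i, ∃ (σ : ℚ) (p : ℚ ×ₗ ℚ), (σ = 1 ∨ σ = -1 ∨ σ = 0) ∧ 0 < p ∧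
      y i = qsmul σ p := by
    intro i
    rcases lt_trichotomy (y i) 0 with hi | hi | hi
    · exact ⟨-1, -(y i), by simp, neg_pos.2 hi, by
        have h1 : qsmul 1 (-(y i)) = -(y i) := by
          simp only [qsmul, one_mul]; rfl
        rw [qs_neg, h1, neg_neg]⟩
    · exact ⟨0, qlex 1, by simp, one_pos', by rw [qs_zero, hi]⟩
    · exact ⟨1, y i, by simp, hi, by simp [qsmul]⟩
  choose σ p hσ hp hyp using habs
  let u0 : Option (Fin d) → ℚ ×ₗ ℚ := fun o => o.elim (qlex 1) p
  have hu0 : ∀ o, 0 < u0 o := by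
    rintro (_ | i)
    · exact one_pos'
    · exact hp i
  have hy' : y = fun i => qsmul (σ i) (u0 (some i)) := funext hyp
  have hev := (Filter.eventually_all_finset Φ).2 (fun a ha =>
    edges_all u0 hu0 (a.tr σ).1 (a.tr σ).2.2.1 (a.tr σ).2.1 (a.tr σ).2.2.2.1 (a.tr σ).2.2.2.2
      ((tr_iff σ u0 rfl a).1 (hy' ▸ hy a ha)))
  obtain ⟨t, ht⟩ := hev.exists
  choose! F hF1 hF2 hF3 using ht
  have habsσ : ∀ i, σ i ≠ 0 → |σ i| = 1 := by
    intro i hi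
    rcases hσ i with h | h | h
    · simp [h]
    · simp [h]
    · exact absurd h hi
  -- properties of the edges
  have hgood : ∀ a ∈ Φ, ∀ e ∈ F a,
      (e.2.1 = none → e.1 ≠ none → PP Φ h 1 e.2.2) ∧
      (e.1 = none → e.2.1 ≠ none → PP Φ h 1 (-e.2.2)) ∧
      (e.1 ≠ none → e.2.1 ≠ none → ∀ m g, PP Φ h m g →
        PP Φ h (m+1) (g + e.2.2) ∧ PP Φ h (m+1) (g - e.2.2)) := by
    intro a ha e he
    obtain ⟨hα, hβ, n, hn, hcase⟩ := hF2 a ha e he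
    have ninv : ∀ (x : ℚ) (n : ℤ), -(toLex (Real.log ((|x| : ℚ)), (n : ℚ)) : GG)
        = toLex (Real.log ((|x⁻¹| : ℚ)), ((-n : ℤ) : ℚ)) := by
      intro x n
      rw [← toLex_neg, abs_inv, Rat.cast_inv, Real.log_inv]
      simp
    have one_var : ∀ (c k : ℚ) (i : Fin d) (s : Bool),
        (Atom.vk c k i s ∈ Φ ∨ Atom.kv k c i s ∈ Φ) → c * σ i ≠ 0 → k ≠ 0 →
        ∀ n : ℤ, n.natAbs ≤ 1 →
          PP Φ h 1 (toLex (Real.log ((|k / (c * σ i)| : ℚ)), (n : ℚ))) := by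
      intro c k i s hm hc hk n hn
      have : |k / (c * σ i)| = |k / c| := by
        rw [abs_div, abs_mul, habsσ i (right_ne_zero_of_mul hc), mul_one, abs_div]
      rw [this]
      exact PP_base Φ h (k / c) (Or.inl ⟨c, k, i, s, hm, rfl⟩)
        (div_ne_zero hk (left_ne_zero_of_mul hc)) n hn
    cases a with
    | vv c₁ c₂ i j s =>
      simp only [Atom.tr] at hα hβ hcase
      obtain ⟨r, hr⟩ := (hrange (c₁ / c₂)).1 ⟨c₁, c₂, i, j, s, ha, rfl⟩
      have e1 : |c₁ * σ i / (c₂ * σ j)| = |h r| ^ (1 : ℤ) := by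
        rw [hr, zpow_one, abs_div, abs_mul, abs_mul, habsσ i (right_ne_zero_of_mul hα),
          habsσ j (right_ne_zero_of_mul hβ), mul_one, mul_one, abs_div]
      have e2 : |c₂ * σ j / (c₁ * σ i)| = |h r| ^ (-1 : ℤ) := by
        rw [zpow_neg, ← e1, ← abs_inv, inv_div]
      have hb : e.1 ≠ none ∧ e.2.1 ≠ none := by
        rcases hcase with ⟨h1, h2, -⟩ | ⟨h1, h2, -⟩ <;> simp [h1, h2]
      refine ⟨fun h => absurd h hb.2, fun h => absurd h hb.1, fun _ _ m g hg => ?_⟩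
      rcases hcase with ⟨-, -, h3⟩ | ⟨-, -, h3⟩
      · rw [h3, sub_eq_add_neg, ninv, inv_div, e1, e2]
        exact ⟨PP_step Φ h hne m g hg r _ (by simp) _ hn,
          PP_step Φ h hne m g hg r _ (by simp) _ (by omega)⟩
      · rw [h3, sub_eq_add_neg, ninv, inv_div, e1, e2]
        exact ⟨PP_step Φ h hne m g hg r _ (by simp) _ hn,
          PP_step Φ h hne m g hg r _ (by simp) _ (by omega)⟩
    | vk c k i s =>
      simp only [Atom.tr] at hα hβ hcase
      rcases hcase with ⟨h1, h2, h3⟩ | ⟨h1, h2, h3⟩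
      · simp only [h1, h2, h3]
        simp only [ne_eq, reduceCtorEq, not_false_eq_true, not_true_eq_false, forall_const,
          false_implies, implies_true, and_true]
        exact one_var c k i s (Or.inl ha) hα hβ n hn
      · simp only [h1, h2, h3, ninv, inv_div]
        simp only [ne_eq, reduceCtorEq, not_false_eq_true, not_true_eq_false, forall_const,
          false_implies, implies_true, and_true, true_and]
        exact one_var c k i s (Or.inl ha) hα hβ _ (by omega)
    | kv k c i s =>
      simp only [Atom.tr] at hα hβ hcase
      rcases hcase with ⟨h1, h2, h3⟩ | ⟨h1, h2, h3⟩
      · simp only [h1, h2, h3, ninv, inv_div]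
        simp only [ne_eq, reduceCtorEq, not_false_eq_true, not_true_eq_false, forall_const,
          false_implies, implies_true, and_true, true_and]
        exact one_var c k i s (Or.inr ha) hβ hα _ (by omega)
      · simp only [h1, h2, h3]
        simp only [ne_eq, reduceCtorEq, not_false_eq_true, not_true_eq_false, forall_const,
          false_implies, implies_true, and_true]
        exact one_var c k i s (Or.inr ha) hβ hα n hn
  obtain ⟨v, B, hvo, hv, -, hBc, hBP⟩ := core_step (none : Option (Fin d)) (Φ.biUnion F) (PP Φ h)
    (fun o => VV t (u0 o))
    (by
      simp [u0, VV, qlex])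
    (by
      intro e he
      obtain ⟨a, ha, hea⟩ := Finset.mem_biUnion.1 he
      exact hF1 a ha e hea)
    (PP_mono Φ h)
    (by
      intro e he
      obtain ⟨a, ha, hea⟩ := Finset.mem_biUnion.1 he
      exact (hgood a ha e hea).1)
    (by
      intro e he
      obtain ⟨a, ha, hea⟩ := Finset.mem_biUnion.1 he
      exact (hgood a ha e hea).2.1)
    (by
      intro e he
      obtain ⟨a, ha, hea⟩ := Finset.mem_biUnion.1 he
      exact (hgood a ha e hea).2.2)
    (by
      have := PP_base Φ h 1 (Or.inr rfl) one_ne_zero 0 (by simp)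
      simp at this
      exact this)
    d (by simp)
  have hBuniv : B = Finset.univ := by
    apply Finset.eq_univ_of_card
    rw [hBc]; simp
  have hP : ∀ i : Fin d, PP Φ h d (v (some i)) := fun i => hBP _ (by simp [hBuniv]) (by simp)
  choose k hk hk0 e he n hn hg using hP
  let x : Fin d → ℚ := fun i => |k i| * ∏ r, |h r| ^ (e i r)
  have hx : ∀ i, 0 < x i := fun i =>
    mul_pos (abs_pos.2 (hk0 i)) (Finset.prod_pos fun q _ => zpow_pos (abs_pos.2 (hne q)) _)
  let u : Option (Fin d) → ℚ ×ₗ ℚ := fun o => o.elim (qlex 1) fun i => toLex (x i, n i * x i)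
  have hdec : ∀ o, Dec (u o) (v o) := by
    rintro (_ | i)
    · refine ⟨1, 0, one_pos, by simp [u, qlex], ?_⟩
      rw [hvo]; simp; rfl
    · exact ⟨x i, n i, hx i, rfl, hg i⟩
  refine ⟨fun i => qsmul (σ i) (u (some i)), ?_, ?_⟩
  · intro i
    have hC : toLex (x i, (n i : ℚ) * x i) ∈ CstarSet Φ := by
      have := hn i
      exact ⟨x i, ⟨k i, hk i, s, h, e i, hinj, hrange, he i, rfl⟩, n i, by omega, by omega, rfl⟩
    rcases hσ i with h1 | h1 | h1
    · right; right
      simpa [h1, qsmul, u] using hC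
    · left
      exact ⟨_, hC, by simp [h1, qsmul, u]⟩
    · right; left
      simp [h1, qsmul]
  · intro a ha
    rw [tr_iff σ u rfl a]
    exact hF3 a ha u v hdec fun e he => hv e (Finset.mem_biUnion.2 ⟨a, ha, he⟩)
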